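/- arXiv:2006.10309 — 3 statements merged into one kernel-verified Lean document; each statement's English description precedes it below -/
import Mathlib

section
/- Under Hypothesis (A), there exist constants λ_i, L_i ≥ 0 (i = 1, …, n) such that |λ_{s,t}^{(i)}| ≤ λ_i ω_{s,t}^{i/p} and |exp_▷(θ λ_{s,t})^{(i)}| ≤ L_i ω_{s,t}^{i/p} for every (s,t) ∈ T_+^2, every 0 ≤ θ ≤ 1 and every i = 1, …, n. -/
open scoped BigOperators

section Graded

variable {W : Type*} [NormedRing W] [NormedAlgebra ℝ W]
variable (𝒲 : ℕ → Submodule ℝ W) [GradedAlgebra 𝒲]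

/-- The degree-`i` component `α^{(i)}` of `α` in the graded algebra `W = ⊕ W_i`. -/
noncomputable def wproj (i : ℕ) (α : W) : W := (DirectSum.decompose 𝒲 α i : W)

variable (n : ℕ)

/-- The truncated product `α ▷ β := Σ_{0 ≤ i+j ≤ n} α^{(i)} β^{(j)}`. -/
noncomputable def btr (α β : W) : W :=
  ∑ i ∈ Finset.range (n + 1), ∑ j ∈ Finset.range (n + 1 - i), wproj 𝒲 i α * wproj 𝒲 j β

/-- The product `α ▶ β := Σ_{i+j ≥ n+1} α^{(i)} β^{(j)}`, the part of `α * β` above degree `n`. -/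
noncomputable def bthen (α β : W) : W := α * β - btr 𝒲 n α β

/-- Right-to-left powers for `▷`: `α^{▷0} = 1`, `α^{▷(k+1)} = α ▷ α^{▷k}`. -/
noncomputable def powG (α : W) : ℕ → W
  | 0 => 1
  | k + 1 => btr 𝒲 n α (powG α k)

/-- `exp_▷(α) := Σ_{k ≥ 0} α^{▷k} / k!`. -/
noncomputable def expG (α : W) : W :=
  ∑' k : ℕ, ((k.factorial : ℝ))⁻¹ • powG 𝒲 n α k

/-- `log_▷(1 + α) := Σ_{k ≥ 1} (-1)^{k+1} α^{▷k} / k` (written in `β = 1 + α`). -/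
noncomputable def logG (β : W) : W :=
  ∑' k : ℕ, ((-1 : ℝ) ^ (k + 1) / k) • powG 𝒲 n (β - 1) k

/-- Membership in `W_{≤n}`: all components of degree `> n` vanish. -/
def inWle (α : W) : Prop := ∀ i : ℕ, n < i → wproj 𝒲 i α = 0

/-- `α ⊛ β := log_▷(exp_▷(α) ▷ exp_▷(β))`. -/
noncomputable def starG (α β : W) : W := logG 𝒲 n (btr 𝒲 n (expG 𝒲 n α) (expG 𝒲 n β))

end Graded

/-- A control: a superadditive nonnegative function on the simplex
`{0 ≤ s ≤ t ≤ T}`, continuous near its diagonal. -/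
def IsControl (T : ℝ) (ω : ℝ → ℝ → ℝ) : Prop :=
  (∀ s t : ℝ, 0 ≤ s → s ≤ t → t ≤ T → 0 ≤ ω s t) ∧
  (∀ r s t : ℝ, 0 ≤ r → r ≤ s → s ≤ t → t ≤ T → ω r s + ω s t ≤ ω r t) ∧
  (∀ a : ℝ, 0 ≤ a → a ≤ T →
    ContinuousWithinAt (fun q : ℝ × ℝ => ω q.1 q.2)
      {q : ℝ × ℝ | 0 ≤ q.1 ∧ q.1 ≤ q.2 ∧ q.2 ≤ T} (a, a))

section GradedBounds

variable {W : Type*} [NormedRing W] [NormedAlgebra ℝ W]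
variable (𝒲 : ℕ → Submodule ℝ W) [GradedAlgebra 𝒲]

lemma wproj_sub (i : ℕ) (α β : W) : wproj 𝒲 i (α - β) = wproj 𝒲 i α - wproj 𝒲 i β := by
  simp [wproj, DirectSum.decompose_sub]

lemma wproj_smul (i : ℕ) (c : ℝ) (α : W) : wproj 𝒲 i (c • α) = c • wproj 𝒲 i α := by
  simp only [wproj, DirectSum.decompose_smul]
  rfl

lemma wproj_sum {κ : Type*} (i : ℕ) (s : Finset κ) (f : κ → W) :
    wproj 𝒲 i (∑ k ∈ s, f k) = ∑ k ∈ s, wproj 𝒲 i (f k) :=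
  map_sum (GradedAlgebra.proj 𝒲 i) f s

lemma wproj_of_mem {j : ℕ} {α : W} (hα : α ∈ 𝒲 j) (i : ℕ) :
    wproj 𝒲 i α = if j = i then α else 0 := by
  split_ifs with h
  · subst h
    exact DirectSum.decompose_of_mem_same 𝒲 hα
  · exact DirectSum.decompose_of_mem_ne 𝒲 hα h

lemma wproj_mem (i : ℕ) (α : W) : wproj 𝒲 i α ∈ 𝒲 i := SetLike.coe_mem _

lemma wproj_one (i : ℕ) : wproj 𝒲 i (1 : W) = if 0 = i then 1 else 0 :=
  wproj_of_mem 𝒲 SetLike.GradedOne.one_mem i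

lemma eq_zero_of_wproj_eq_zero {α : W} (h : ∀ i, wproj 𝒲 i α = 0) : α = 0 := by
  apply (DirectSum.decompose 𝒲).injective
  rw [DirectSum.decompose_zero]
  ext i
  exact h i

lemma wproj_btr (n m : ℕ) (α β : W) :
    wproj 𝒲 m (btr 𝒲 n α β) = ∑ i ∈ Finset.range (n + 1), ∑ j ∈ Finset.range (n + 1 - i),
      if i + j = m then wproj 𝒲 i α * wproj 𝒲 j β else 0 := by
  simp only [btr, wproj_sum]
  refine Finset.sum_congr rfl fun i _ => Finset.sum_congr rfl fun j _ => ?_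
  exact wproj_of_mem 𝒲 (SetLike.GradedMul.mul_mem (wproj_mem 𝒲 i α) (wproj_mem 𝒲 j β)) m

lemma wproj_powG_of_lt {n : ℕ} {α : W} (hα : wproj 𝒲 0 α = 0) :
    ∀ {k m : ℕ}, m < k → wproj 𝒲 m (powG 𝒲 n α k) = 0
  | 0, _, h => absurd h (Nat.not_lt_zero _)
  | k + 1, m, h => by
    rw [powG, wproj_btr]
    refine Finset.sum_eq_zero fun i _ => Finset.sum_eq_zero fun j _ => ?_
    split_ifs with hij
    · rcases Nat.eq_zero_or_pos i with rfl | hi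
      · rw [hα, zero_mul]
      · rw [wproj_powG_of_lt hα (by omega : j < k), mul_zero]
    · rfl

lemma powG_eq_zero {n : ℕ} {α : W} (hα : wproj 𝒲 0 α = 0) {k : ℕ} (hk : n < k) :
    powG 𝒲 n α k = 0 := by
  refine eq_zero_of_wproj_eq_zero 𝒲 fun m => ?_
  rcases lt_or_ge m k with hm | hm
  · exact wproj_powG_of_lt 𝒲 hα hm
  · obtain ⟨k, rfl⟩ := Nat.exists_eq_succ_of_ne_zero (by omega : k ≠ 0)
    rw [powG, wproj_btr]
    refine Finset.sum_eq_zero fun i hi => Finset.sum_eq_zero fun j hj => if_neg ?_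
    rw [Finset.mem_range] at hi hj
    omega

lemma tsum_smul_powG {n : ℕ} {α : W} (hα : wproj 𝒲 0 α = 0) (c : ℕ → ℝ) :
    ∑' k : ℕ, c k • powG 𝒲 n α k = ∑ k ∈ Finset.range (n + 1), c k • powG 𝒲 n α k := by
  refine tsum_eq_sum fun k hk => ?_
  rw [Finset.mem_range] at hk
  rw [powG_eq_zero 𝒲 hα (by omega), smul_zero]

lemma wproj_zero_logG {n : ℕ} {β : W} (hβ : wproj 𝒲 0 (β - 1) = 0) :
    wproj 𝒲 0 (logG 𝒲 n β) = 0 := by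
  rw [logG, tsum_smul_powG 𝒲 hβ, wproj_sum]
  refine Finset.sum_eq_zero fun k _ => ?_
  rw [wproj_smul]
  rcases Nat.eq_zero_or_pos k with rfl | hk
  · simp
  · rw [wproj_powG_of_lt 𝒲 hβ hk, smul_zero]

/-- The family `f` satisfies homogeneous bounds with scale `a`: in each degree `i`, the component
`f(z)^{(i)}` is bounded by a multiple of `a(z)^i`, uniformly in `z`. -/
def HasGradedBound {ι : Type*} (a : ι → ℝ) (f : ι → W) : Prop :=
  ∀ i : ℕ, ∃ C : ℝ, 0 ≤ C ∧ ∀ z, ‖wproj 𝒲 i (f z)‖ ≤ C * a z ^ i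

namespace HasGradedBound

variable {𝒲} {ι : Type*} {a : ι → ℝ} {f g : ι → W}

lemma one : HasGradedBound 𝒲 a (fun _ => 1) := by
  intro i
  refine ⟨‖wproj 𝒲 i (1 : W)‖, norm_nonneg _, fun z => ?_⟩
  rw [wproj_one]
  split_ifs with h
  · simp [← h]
  · simp

lemma sub (hf : HasGradedBound 𝒲 a f) (hg : HasGradedBound 𝒲 a g) :
    HasGradedBound 𝒲 a (fun z => f z - g z) := by
  intro i
  obtain ⟨C, hC, hf⟩ := hf i
  obtain ⟨D, hD, hg⟩ := hg i
  refine ⟨C + D, add_nonneg hC hD, fun z => ?_⟩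
  rw [wproj_sub, add_mul]
  exact (norm_sub_le _ _).trans (add_le_add (hf z) (hg z))

lemma smul (hf : HasGradedBound 𝒲 a f) {c : ι → ℝ} {K : ℝ} (hK : 0 ≤ K)
    (hc : ∀ z, |c z| ≤ K) : HasGradedBound 𝒲 a (fun z => c z • f z) := by
  intro i
  obtain ⟨C, hC, hf⟩ := hf i
  refine ⟨K * C, mul_nonneg hK hC, fun z => ?_⟩
  rw [wproj_smul, norm_smul, Real.norm_eq_abs, mul_assoc]
  exact mul_le_mul (hc z) (hf z) (norm_nonneg _) hK

lemma sum {κ : Type*} (s : Finset κ) {f : κ → ι → W} (hf : ∀ k, HasGradedBound 𝒲 a (f k)) :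
    HasGradedBound 𝒲 a (fun z => ∑ k ∈ s, f k z) := by
  intro i
  choose C hC hf using fun k => hf k i
  refine ⟨∑ k ∈ s, C k, Finset.sum_nonneg fun k _ => hC k, fun z => ?_⟩
  rw [wproj_sum, Finset.sum_mul]
  exact norm_sum_le_of_le _ fun k _ => hf k z

lemma btr (ha : ∀ z, 0 ≤ a z) (n : ℕ) (hf : HasGradedBound 𝒲 a f) (hg : HasGradedBound 𝒲 a g) :
    HasGradedBound 𝒲 a (fun z => btr 𝒲 n (f z) (g z)) := by
  intro m
  choose C hC hf using hf
  choose D hD hg using hg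
  refine ⟨∑ i ∈ Finset.range (n + 1), ∑ j ∈ Finset.range (n + 1 - i),
    if i + j = m then C i * D j else 0, ?_, fun z => ?_⟩
  · refine Finset.sum_nonneg fun i _ => Finset.sum_nonneg fun j _ => ?_
    split_ifs
    · exact mul_nonneg (hC i) (hD j)
    · exact le_rfl
  · rw [wproj_btr, Finset.sum_mul]
    refine norm_sum_le_of_le _ fun i _ => ?_
    rw [Finset.sum_mul]
    refine norm_sum_le_of_le _ fun j _ => ?_
    split_ifs with h
    · calc ‖wproj 𝒲 i (f z) * wproj 𝒲 j (g z)‖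
          ≤ ‖wproj 𝒲 i (f z)‖ * ‖wproj 𝒲 j (g z)‖ := norm_mul_le _ _
        _ ≤ (C i * a z ^ i) * (D j * a z ^ j) :=
            mul_le_mul (hf i z) (hg j z) (norm_nonneg _)
              (mul_nonneg (hC i) (pow_nonneg (ha z) i))
        _ = C i * D j * a z ^ m := by rw [← h, pow_add]; ring
    · simp

lemma powG (ha : ∀ z, 0 ≤ a z) (n : ℕ) (hf : HasGradedBound 𝒲 a f) :
    ∀ k : ℕ, HasGradedBound 𝒲 a (fun z => powG 𝒲 n (f z) k)
  | 0 => one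
  | k + 1 => hf.btr ha n (hf.powG ha n k)

lemma tsum_smul_powG (ha : ∀ z, 0 ≤ a z) (n : ℕ) (hf : HasGradedBound 𝒲 a f)
    (hf0 : ∀ z, wproj 𝒲 0 (f z) = 0) (c : ℕ → ℝ) :
    HasGradedBound 𝒲 a (fun z => ∑' k : ℕ, c k • _root_.powG 𝒲 n (f z) k) := by
  simp only [fun z => _root_.tsum_smul_powG 𝒲 (n := n) (hf0 z) c]
  exact sum _ fun k => (hf.powG ha n k).smul (abs_nonneg (c k)) fun _ => le_rfl

lemma logG (ha : ∀ z, 0 ≤ a z) (n : ℕ) (hf : HasGradedBound 𝒲 a f)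
    (hf0 : ∀ z, wproj 𝒲 0 (f z - 1) = 0) : HasGradedBound 𝒲 a (fun z => logG 𝒲 n (f z)) :=
  (hf.sub one).tsum_smul_powG ha n hf0 _

lemma expG (ha : ∀ z, 0 ≤ a z) (n : ℕ) (hf : HasGradedBound 𝒲 a f)
    (hf0 : ∀ z, wproj 𝒲 0 (f z) = 0) : HasGradedBound 𝒲 a (fun z => expG 𝒲 n (f z)) :=
  hf.tsum_smul_powG ha n hf0 _

end HasGradedBound

end GradedBounds

/-- Under Hypothesis (A), there exist constants `λ_i, L_i ≥ 0` (`i = 1, …, n`) such that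
`|λ_{s,t}^{(i)}| ≤ λ_i ω_{s,t}^{i/p}` and `|exp_▷(θ λ_{s,t})^{(i)}| ≤ L_i ω_{s,t}^{i/p}` for
every `(s,t) ∈ T_+^2`, every `0 ≤ θ ≤ 1` and every `i = 1, …, n`. -/
theorem bounds_on_log_and_exp_of_rough_path
    {W : Type*} [NormedRing W] [NormedAlgebra ℝ W]
    (𝒲 : ℕ → Submodule ℝ W) [GradedAlgebra 𝒲] (n : ℕ)
    -- the norm of the Banach algebra `W` is graded: `|α| = Σ_i |α^{(i)}|`
    (hnorm : ∀ α : W, HasSum (fun i : ℕ => ‖wproj 𝒲 i α‖) ‖α‖)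
    -- time horizon, control, exponent `p`
    (T p : ℝ) (hT : 0 ≤ T) (hp : 1 ≤ p) (hnp : Nat.floor p ≤ n)
    (ω : ℝ → ℝ → ℝ) (hω : IsControl T ω)
    -- Hypothesis (A): `x` is a `W_{≤n}`-valued `p`-rough path
    (x : ℝ → ℝ → W) (μ : ℕ → ℝ)
    (hxle : ∀ s t : ℝ, 0 ≤ s → s ≤ t → t ≤ T → inWle 𝒲 n (x s t))
    (hx0 : ∀ s t : ℝ, 0 ≤ s → s ≤ t → t ≤ T → wproj 𝒲 0 (x s t) = 1)
    (hxbd : ∀ i : ℕ, 1 ≤ i → ∀ s t : ℝ, 0 ≤ s → s ≤ t → t ≤ T →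
      ‖wproj 𝒲 i (x s t)‖ ≤ μ i * ω s t ^ ((i : ℝ) / p))
    (hxmul : ∀ r s t : ℝ, 0 ≤ r → r ≤ s → s ≤ t → t ≤ T →
      btr 𝒲 n (x r s) (x s t) = x r t) :
    ∃ lam Lc : ℕ → ℝ,
      ∀ i : ℕ, 1 ≤ i → i ≤ n →
        0 ≤ lam i ∧ 0 ≤ Lc i ∧
        ∀ s t : ℝ, 0 ≤ s → s ≤ t → t ≤ T → ∀ θ : ℝ, 0 ≤ θ → θ ≤ 1 →
          ‖wproj 𝒲 i (logG 𝒲 n (x s t))‖ ≤ lam i * ω s t ^ ((i : ℝ) / p) ∧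
          ‖wproj 𝒲 i (expG 𝒲 n (θ • logG 𝒲 n (x s t)))‖ ≤ Lc i * ω s t ^ ((i : ℝ) / p) := by
  let ι := {z : ℝ × ℝ × ℝ // 0 ≤ z.1 ∧ z.1 ≤ z.2.1 ∧ z.2.1 ≤ T ∧ 0 ≤ z.2.2 ∧ z.2.2 ≤ 1}
  let a : ι → ℝ := fun z => ω z.1.1 z.1.2.1 ^ (1 / p)
  let X : ι → W := fun z => x z.1.1 z.1.2.1
  have hω0 : ∀ z : ι, 0 ≤ ω z.1.1 z.1.2.1 := fun z => hω.1 _ _ z.2.1 z.2.2.1 z.2.2.2.1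
  have ha : ∀ z, 0 ≤ a z := fun z => Real.rpow_nonneg (hω0 z) _
  have hpow : ∀ (i : ℕ) (z : ι), a z ^ i = ω z.1.1 z.1.2.1 ^ ((i : ℝ) / p) := fun i z => by
    rw [← Real.rpow_mul_natCast (hω0 z), one_div_mul_eq_div]
  have hX : HasGradedBound 𝒲 a X := by
    intro i
    rcases Nat.eq_zero_or_pos i with rfl | hi
    · refine ⟨‖(1 : W)‖, norm_nonneg _, fun z => ?_⟩
      rw [hx0 _ _ z.2.1 z.2.2.1 z.2.2.2.1, pow_zero, mul_one]
    · refine ⟨|μ i|, abs_nonneg _, fun z => ?_⟩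
      rw [hpow]
      exact (hxbd i hi _ _ z.2.1 z.2.2.1 z.2.2.2.1).trans
        (mul_le_mul_of_nonneg_right (le_abs_self _) (Real.rpow_nonneg (hω0 z) _))
  have hX0 : ∀ z, wproj 𝒲 0 (X z - 1) = 0 := fun z => by
    rw [wproj_sub, hx0 _ _ z.2.1 z.2.2.1 z.2.2.2.1, wproj_one, if_pos rfl, sub_self]
  have hlog := hX.logG ha n hX0
  have hexp := (hlog.smul (c := fun z => z.1.2.2) zero_le_one fun z =>
    (abs_of_nonneg z.2.2.2.2.1).le.trans z.2.2.2.2.2).expG ha n fun z => by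
      rw [wproj_smul, wproj_zero_logG 𝒲 (hX0 z), smul_zero]
  choose C hC hlog using hlog
  choose D hD hexp using hexp
  refine ⟨C, D, fun i _ _ => ⟨hC i, hD i, fun s t hs hst ht θ hθ hθ1 => ?_⟩⟩
  let z : ι := ⟨(s, t, θ), hs, hst, ht, hθ, hθ1⟩
  have hz := hpow i z
  exact ⟨(hlog i z).trans_eq (by rw [hz]), (hexp i z).trans_eq (by rw [hz])⟩
end

section
/- Taylor expansion of ODE solutions in the word algebra: Let α = Σ_{i∈I} m_i i and let y be the unique solution of y_t = a + ∫_0^t Σ_{i∈I} m_i f_i(y_s) ds = a + ∫_0^t F[α](y_s) ds. Then for every word w ∈ W_{≤n}, F[w](y_t) = Σ_{k=0}^{n−|w|} (t^k/k!) Σ_{i_1⋯i_k ∈ I^k} m_{i_1⋯i_k} F[i_1⋯i_k w](a) + R(t,a), where R(t,a) = ∫_0^t ((t−s)^{n−|w|}/(n−|w|)!) Σ_{i_1⋯i_{n+1−|w|} ∈ I^{n+1−|w|}} m_{i_1⋯i_{n+1−|w|}} F[i_1⋯i_{n+1−|w|} w](y_s) ds. -/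
open scoped BigOperators
open MeasureTheory

/-- The elementary differentials indexed by words: `F[∅] = id`, `F[i] = f_i` and
`F[i w](a) = D F[w](a) · f_i(a)`. -/
noncomputable def wordF {I : Type*} {V : Type*} [NormedAddCommGroup V] [NormedSpace ℝ V]
    (f : I → V → V) : List I → V → V
  | [] => id
  | i :: w => fun a => fderiv ℝ (wordF f w) a (f i a)

theorem contDiff_wordF {I V : Type*} [NormedAddCommGroup V] [NormedSpace ℝ V]
    {n : ℕ} {f : I → V → V} (hf : ∀ i, ContDiff ℝ n (f i)) (w : List I) {k : ℕ}
    (hk : k + w.length ≤ n + 1) : ContDiff ℝ k (wordF f w) := by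
  induction w generalizing k with
  | nil => exact contDiff_id
  | cons i w ih =>
    simp only [List.length_cons] at hk
    exact ((ih (k := k + 1) (by omega)).fderiv_right (by norm_cast)).clm_apply
      ((hf i).of_le (by exact_mod_cast (by omega : k ≤ n)))

theorem hasDerivAt_taylor_sum {V : Type*} [NormedAddCommGroup V] [NormedSpace ℝ V]
    {g : ℕ → ℝ → V} {s : ℝ} (t : ℝ) {N : ℕ}
    (hg : ∀ k ≤ N, HasDerivAt (g k) (g (k + 1) s) s) :
    HasDerivAt (fun r => ∑ k ∈ Finset.range (N + 1),
        ((t - r) ^ k / (k.factorial : ℝ)) • g k r)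
      (((t - s) ^ N / (N.factorial : ℝ)) • g (N + 1) s) s := by
  induction N with
  | zero => simpa using hg 0 le_rfl
  | succ N ih =>
    simp only [Finset.sum_range_succ _ (N + 1)]
    have hpow : HasDerivAt (fun r : ℝ => (t - r) ^ (N + 1) / ((N + 1).factorial : ℝ))
        (-((t - s) ^ N / (N.factorial : ℝ))) s := by
      refine ((((hasDerivAt_id s).const_sub t).pow (N + 1)).div_const
        ((N + 1).factorial : ℝ)).congr_deriv ?_
      rw [Nat.factorial_succ]
      push_cast
      have : (N.factorial : ℝ) ≠ 0 := by positivity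
      have : (N : ℝ) + 1 ≠ 0 := by positivity
      simp
      field_simp
    refine ((ih fun k hk => hg k (by omega)).add
      (hpow.smul (hg (N + 1) le_rfl))).congr_deriv ?_
    simp only [neg_smul]
    abel

theorem taylor_integral_remainder_of_hasDerivAt {V : Type*} [NormedAddCommGroup V]
    [NormedSpace ℝ V] [CompleteSpace V] {g : ℕ → ℝ → V} {t : ℝ} (ht : 0 ≤ t) {N : ℕ}
    (hcont : ∀ k ≤ N + 1, Continuous (g k))
    (hg : ∀ k ≤ N, ∀ s ∈ Set.Ioo 0 t, HasDerivAt (g k) (g (k + 1) s) s) :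
    g 0 t = ∑ k ∈ Finset.range (N + 1), (t ^ k / (k.factorial : ℝ)) • g k 0
      + ∫ s in (0:ℝ)..t, ((t - s) ^ N / (N.factorial : ℝ)) • g (N + 1) s := by
  have hΦ : Continuous fun r => ∑ k ∈ Finset.range (N + 1),
      ((t - r) ^ k / (k.factorial : ℝ)) • g k r :=
    continuous_finsetSum _ fun k hk => by
      have := hcont k (Finset.mem_range.mp hk).le
      fun_prop
  have hR : Continuous fun s => ((t - s) ^ N / (N.factorial : ℝ)) • g (N + 1) s := by
    have := hcont (N + 1) le_rfl
    fun_prop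
  rw [intervalIntegral.integral_eq_sub_of_hasDerivAt_of_le ht hΦ.continuousOn
    (fun s hs => hasDerivAt_taylor_sum t fun k hk => hg k hk s hs)
    (hR.intervalIntegrable _ _)]
  simp [Finset.sum_range_succ']

theorem sum_prod_fin_succ_wordF {I V : Type*} [Fintype I] [NormedAddCommGroup V]
    [NormedSpace ℝ V] (f : I → V → V) (m : I → ℝ) (w : List I) (k : ℕ) (x : V) :
    ∑ u : Fin (k + 1) → I, (∏ j, m (u j)) • wordF f (List.ofFn u ++ w) x
      = ∑ u : Fin k → I, (∏ j, m (u j)) •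
          fderiv ℝ (wordF f (List.ofFn u ++ w)) x (∑ i, m i • f i x) := by
  rw [← (Fin.consEquiv fun _ => I).sum_comp, Fintype.sum_prod_type, Finset.sum_comm]
  refine Finset.sum_congr rfl fun u _ => ?_
  rw [map_sum, Finset.smul_sum]
  refine Finset.sum_congr rfl fun i _ => ?_
  simp [Fin.consEquiv, Fin.prod_univ_succ, List.ofFn_succ, wordF, smul_smul, mul_comm]

/-- **Taylor expansion of ODE solutions in the word algebra.**
Let `α = Σ_{i∈I} m_i i` and let `y` be the unique solution of
`y_t = a + ∫_0^t Σ_{i∈I} m_i f_i(y_s) ds`. Then for every word `w ∈ W_{≤n}`,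
`F[w](y_t) = Σ_{k=0}^{n−|w|} (t^k/k!) Σ_{i_1⋯i_k} m_{i_1⋯i_k} F[i_1⋯i_k w](a) + R(t,a)` with
`R(t,a) = ∫_0^t ((t−s)^{n−|w|}/(n−|w|)!) Σ_{i_1⋯i_{n+1−|w|}} m_{i_1⋯i_{n+1−|w|}}
  F[i_1⋯i_{n+1−|w|} w](y_s) ds`. -/
theorem taylor_expansion_of_ODE_in_word_algebra
    {I : Type*} [Fintype I]
    {V : Type*} [NormedAddCommGroup V] [NormedSpace ℝ V] [CompleteSpace V]
    (n : ℕ) (hn : 0 < n)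
    -- the vector fields `f_i`, of class `C^n` and globally Lipschitz
    (f : I → V → V)
    (hfC : ∀ i : I, ContDiff ℝ n (f i))
    (hflip : ∀ i : I, ∃ K : NNReal, LipschitzWith K (f i))
    -- the weights `m_i`
    (m : I → ℝ)
    -- `y` is the solution of the ODE `y_t = a + ∫_0^t Σ_i m_i f_i(y_s) ds`
    (a : V) (y : ℝ → V) (hycont : Continuous y)
    (hy : ∀ t : ℝ, 0 ≤ t → y t = a + ∫ s in (0:ℝ)..t, ∑ i : I, m i • f i (y s))
    -- a word `w` of length at most `n`
    (w : List I) (hw : w.length ≤ n)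
    (t : ℝ) (ht : 0 ≤ t) :
    wordF f w (y t)
      = (∑ k ∈ Finset.range (n - w.length + 1),
          (t ^ k / (k.factorial : ℝ)) •
            ∑ u : Fin k → I,
              (∏ j : Fin k, m (u j)) • wordF f (List.ofFn u ++ w) a)
        + ∫ s in (0:ℝ)..t,
            ((t - s) ^ (n - w.length) / ((n - w.length).factorial : ℝ)) •
              ∑ u : Fin (n + 1 - w.length) → I,
                (∏ j : Fin (n + 1 - w.length), m (u j)) •
                  wordF f (List.ofFn u ++ w) (y s) := by
  have hf (i : I) : Continuous (f i) := (hfC i).continuous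
  have hY : Continuous fun s => ∑ i : I, m i • f i (y s) := by fun_prop
  have hy0 : y 0 = a := by simpa using hy 0 le_rfl
  have hyderiv (s : ℝ) (hs : 0 < s) : HasDerivAt y (∑ i : I, m i • f i (y s)) s := by
    refine ((hY.integral_hasStrictDerivAt 0 s).hasDerivAt.const_add a).congr_of_eventuallyEq ?_
    filter_upwards [lt_mem_nhds hs] with r hr using hy r hr.le
  obtain ⟨N, rfl⟩ := Nat.exists_eq_add_of_le hw
  rw [show w.length + N + 1 - w.length = N + 1 by omega, Nat.add_sub_cancel_left]
  have key := taylor_integral_remainder_of_hasDerivAt (N := N) ht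
    (g := fun k s => ∑ u : Fin k → I, (∏ j, m (u j)) • wordF f (List.ofFn u ++ w) (y s))
    (fun k hk => continuous_finsetSum _ fun u _ =>
      (((contDiff_wordF (k := 0) hfC (List.ofFn u ++ w) (by simp; omega)).continuous).comp
        hycont).const_smul _)
    (fun k hk s hs => by
      rw [sum_prod_fin_succ_wordF]
      refine HasDerivAt.fun_sum fun u _ => HasDerivAt.const_smul _ ?_
      have hd : Differentiable ℝ (wordF f (List.ofFn u ++ w)) :=
        (contDiff_wordF (k := 1) hfC _ (by simp; omega)).differentiable (by simp)
      exact (hd (y s)).hasFDerivAt.comp_hasDerivAt s (hyderiv s hs.1))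
  simpa [hy0] using key
end

section
/- The Davie approximation is an almost flow: Let x be a T_{≤2}(ℝ^d)-valued p-rough path with 2 ≤ p < 3 controlled by ω, and let f_1, …, f_d: V → V be bounded functions of class C^2 with bounded first and second derivatives. Define φ_{t,s}(a) := a + Σ_{i=1}^d f_i(a) x^{(1),i}_{s,t} + Σ_{i,j=1}^d x^{(2),ij}_{s,t} Df_j(a)·f_i(a). Then φ = {φ_{t,s}} is an almost flow; in particular there exists a constant L such that ‖φ_{t,s} ∘ φ_{s,r} − φ_{t,r}‖_∞ ≤ L ω_{r,t}^{3/p} for all 0 ≤ r ≤ s ≤ t ≤ T. -/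
open scoped BigOperators

section DavieIncrement

variable {V : Type*} [NormedAddCommGroup V] [NormedSpace ℝ V] {d : ℕ} {f : Fin d → V → V}

/-- The increment `φ(a) - a` of the Davie approximation `φ` with vector fields `f`, first level
`u` and second level `A`. -/
noncomputable def davieIncrement (f : Fin d → V → V) (u : Fin d → ℝ) (A : Fin d → Fin d → ℝ)
    (a : V) : V :=
  ∑ i, u i • f i a + ∑ i, ∑ j, A i j • fderiv ℝ (f j) a (f i a)

theorem norm_sum_smul_le {u : Fin d → ℝ} {g : Fin d → V} {α C : ℝ} (hα : 0 ≤ α)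
    (hu : ∀ i, |u i| ≤ α) (hg : ∀ i, ‖g i‖ ≤ C) : ‖∑ i, u i • g i‖ ≤ d * (α * C) := by
  have h : ∀ i ∈ Finset.univ, ‖u i • g i‖ ≤ α * C := fun i _ => by
    rw [norm_smul, Real.norm_eq_abs]
    exact mul_le_mul (hu i) (hg i) (norm_nonneg _) hα
  simpa using norm_sum_le_of_le Finset.univ h

theorem norm_sum_sum_smul_le {A : Fin d → Fin d → ℝ} {g : Fin d → Fin d → V} {β C : ℝ}
    (hβ : 0 ≤ β) (hA : ∀ i j, |A i j| ≤ β) (hg : ∀ i j, ‖g i j‖ ≤ C) :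
    ‖∑ i, ∑ j, A i j • g i j‖ ≤ d * (d * (β * C)) := by
  have h : ∀ i ∈ Finset.univ, ‖∑ j, A i j • g i j‖ ≤ d * (β * C) := fun i _ =>
    norm_sum_smul_le hβ (hA i) (hg i)
  simpa using norm_sum_le_of_le Finset.univ h

variable {C : ℝ}

theorem norm_apply_sub_le_of_norm_fderiv_le {g : V → V} (hd : Differentiable ℝ g)
    (h1 : ∀ a, ‖fderiv ℝ g a‖ ≤ C) (a b : V) : ‖g b - g a‖ ≤ C * ‖b - a‖ :=
  convex_univ.norm_image_sub_le_of_norm_fderiv_le (fun x _ => hd x) (fun x _ => h1 x)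
    (Set.mem_univ a) (Set.mem_univ b)

theorem norm_sub_sub_fderiv_le {g : V → V} (hC : 0 ≤ C) (hd : Differentiable ℝ g)
    (h2 : ∀ a b, ‖fderiv ℝ g b - fderiv ℝ g a‖ ≤ C * ‖b - a‖) (a b : V) :
    ‖g b - g a - fderiv ℝ g a (b - a)‖ ≤ C * ‖b - a‖ ^ 2 := by
  have h := (convex_segment a b).norm_image_sub_le_of_norm_fderiv_le' (𝕜 := ℝ) (f := g)
    (φ := fderiv ℝ g a) (C := C * ‖b - a‖) (fun x _ => hd x)
    (fun x hx => (h2 a x).trans (by gcongr; exact norm_sub_le_of_mem_segment hx))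
    (left_mem_segment ℝ a b) (right_mem_segment ℝ a b)
  linarith

theorem norm_fderiv_apply_le (hC : 0 ≤ C) (h0 : ∀ i a, ‖f i a‖ ≤ C)
    (h1 : ∀ i a, ‖fderiv ℝ (f i) a‖ ≤ C) (i j : Fin d) (a : V) :
    ‖fderiv ℝ (f j) a (f i a)‖ ≤ C * C :=
  (ContinuousLinearMap.le_opNorm _ _).trans (mul_le_mul (h1 j a) (h0 i a) (norm_nonneg _) hC)

theorem norm_fderiv_apply_sub_le (hC : 0 ≤ C) (hd : ∀ i, Differentiable ℝ (f i))
    (h0 : ∀ i a, ‖f i a‖ ≤ C) (h1 : ∀ i a, ‖fderiv ℝ (f i) a‖ ≤ C)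
    (h2 : ∀ i a b, ‖fderiv ℝ (f i) b - fderiv ℝ (f i) a‖ ≤ C * ‖b - a‖) (i j : Fin d) (a b : V) :
    ‖fderiv ℝ (f j) b (f i b) - fderiv ℝ (f j) a (f i a)‖ ≤ 2 * C * C * ‖b - a‖ := by
  have hsplit : fderiv ℝ (f j) b (f i b) - fderiv ℝ (f j) a (f i a)
      = fderiv ℝ (f j) b (f i b - f i a) + (fderiv ℝ (f j) b - fderiv ℝ (f j) a) (f i a) := by
    simp
  have hl : ‖fderiv ℝ (f j) b (f i b - f i a)‖ ≤ C * (C * ‖b - a‖) :=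
    (ContinuousLinearMap.le_opNorm _ _).trans (mul_le_mul (h1 j b)
      (norm_apply_sub_le_of_norm_fderiv_le (hd i) (h1 i) a b) (norm_nonneg _) hC)
  have hr : ‖(fderiv ℝ (f j) b - fderiv ℝ (f j) a) (f i a)‖ ≤ C * ‖b - a‖ * C :=
    (ContinuousLinearMap.le_opNorm _ _).trans
      (mul_le_mul (h2 j a b) (h0 i a) (norm_nonneg _) (by positivity))
  rw [hsplit]
  linarith [norm_add_le (fderiv ℝ (f j) b (f i b - f i a))
    ((fderiv ℝ (f j) b - fderiv ℝ (f j) a) (f i a))]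

theorem norm_davieIncrement_le {u : Fin d → ℝ} {A : Fin d → Fin d → ℝ} {α β : ℝ} (hC : 0 ≤ C)
    (hα : 0 ≤ α) (hβ : 0 ≤ β) (hu : ∀ i, |u i| ≤ α) (hA : ∀ i j, |A i j| ≤ β)
    (h0 : ∀ i a, ‖f i a‖ ≤ C) (h1 : ∀ i a, ‖fderiv ℝ (f i) a‖ ≤ C) (a : V) :
    ‖davieIncrement f u A a‖ ≤ d * (α * C) + d * (d * (β * (C * C))) :=
  norm_add_le_of_le (norm_sum_smul_le hα hu fun i => h0 i a)
    (norm_sum_sum_smul_le hβ hA fun i j => norm_fderiv_apply_le hC h0 h1 i j a)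

theorem norm_davieIncrement_sub_le {u : Fin d → ℝ} {A : Fin d → Fin d → ℝ} {α β : ℝ}
    (hC : 0 ≤ C) (hα : 0 ≤ α) (hβ : 0 ≤ β) (hu : ∀ i, |u i| ≤ α) (hA : ∀ i j, |A i j| ≤ β)
    (hd : ∀ i, Differentiable ℝ (f i)) (h0 : ∀ i a, ‖f i a‖ ≤ C)
    (h1 : ∀ i a, ‖fderiv ℝ (f i) a‖ ≤ C)
    (h2 : ∀ i a b, ‖fderiv ℝ (f i) b - fderiv ℝ (f i) a‖ ≤ C * ‖b - a‖) (a b : V) :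
    ‖davieIncrement f u A b - davieIncrement f u A a‖
      ≤ (d * (α * C) + d * (d * (β * (2 * C * C)))) * ‖b - a‖ := by
  have hsplit : davieIncrement f u A b - davieIncrement f u A a
      = ∑ i, u i • (f i b - f i a)
        + ∑ i, ∑ j, A i j • (fderiv ℝ (f j) b (f i b) - fderiv ℝ (f j) a (f i a)) := by
    simp only [davieIncrement, smul_sub, Finset.sum_sub_distrib]
    abel
  rw [hsplit]
  refine (norm_add_le_of_le
    (norm_sum_smul_le hα hu fun i => norm_apply_sub_le_of_norm_fderiv_le (hd i) (h1 i) a b)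
    (norm_sum_sum_smul_le hβ hA fun i j =>
      norm_fderiv_apply_sub_le hC hd h0 h1 h2 i j a b)).trans_eq ?_
  ring

theorem davieIncrement_comp_sub (u v : Fin d → ℝ) (A B : Fin d → Fin d → ℝ) (a b : V) :
    davieIncrement f v B b + davieIncrement f u A a
        - davieIncrement f (u + v) (fun i j => A i j + B i j + u i * v j) a
      = ∑ j, v j • (f j b - f j a - fderiv ℝ (f j) a (∑ i, u i • f i a))
        + ∑ i, ∑ j, B i j • (fderiv ℝ (f j) b (f i b) - fderiv ℝ (f j) a (f i a)) := by
  have hcross : ∑ i, ∑ j, (u i * v j) • fderiv ℝ (f j) a (f i a)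
      = ∑ j, v j • fderiv ℝ (f j) a (∑ i, u i • f i a) := by
    rw [Finset.sum_comm]
    simp only [map_sum, map_smul, Finset.smul_sum, smul_smul, mul_comm]
  simp only [davieIncrement, Pi.add_apply, add_smul, smul_sub, Finset.sum_add_distrib,
    Finset.sum_sub_distrib, hcross]
  abel

theorem norm_davieIncrement_comp_sub_le {u v : Fin d → ℝ} {A B : Fin d → Fin d → ℝ}
    {M W W₀ : ℝ} (hC : 0 ≤ C) (hM : 0 ≤ M) (hW : 0 ≤ W) (hW₀ : W ≤ W₀)
    (hu : ∀ i, |u i| ≤ M * W) (hv : ∀ i, |v i| ≤ M * W)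
    (hA : ∀ i j, |A i j| ≤ M * W ^ 2) (hB : ∀ i j, |B i j| ≤ M * W ^ 2)
    (hd : ∀ i, Differentiable ℝ (f i)) (h0 : ∀ i a, ‖f i a‖ ≤ C)
    (h1 : ∀ i a, ‖fderiv ℝ (f i) a‖ ≤ C)
    (h2 : ∀ i a b, ‖fderiv ℝ (f i) b - fderiv ℝ (f i) a‖ ≤ C * ‖b - a‖) {K : ℝ}
    (hK : K = d * (M * C) + d * (d * (M * W₀ * (C * C)))) (a : V) :
    ‖davieIncrement f v B (a + davieIncrement f u A a) + davieIncrement f u A a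
        - davieIncrement f (u + v) (fun i j => A i j + B i j + u i * v j) a‖
      ≤ (d * (M * (C * K ^ 2 + C * (d * (d * (M * (C * C))))))
          + d * (d * (M * (2 * C * C * K)))) * W ^ 3 := by
  have hMW : 0 ≤ M * W := by positivity
  have hMW2 : 0 ≤ M * W ^ 2 := by positivity
  set b := a + davieIncrement f u A a with hb
  have hba : b - a = davieIncrement f u A a := by simp [hb]
  have hbaK : ‖b - a‖ ≤ K * W := by
    rw [hba, hK]
    refine (norm_davieIncrement_le hC hMW hMW2 hu hA h0 h1 a).trans ?_
    have : (d : ℝ) * (d * (M * W ^ 2 * (C * C))) ≤ d * (d * (M * (W₀ * W) * (C * C))) := by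
      gcongr
      nlinarith
    linarith
  have hrem : ∀ j, ‖f j b - f j a - fderiv ℝ (f j) a (∑ i, u i • f i a)‖
      ≤ C * (K * W) ^ 2 + C * (d * (d * (M * W ^ 2 * (C * C)))) := fun j => by
    have hsplit : f j b - f j a - fderiv ℝ (f j) a (∑ i, u i • f i a)
        = (f j b - f j a - fderiv ℝ (f j) a (b - a))
          + fderiv ℝ (f j) a (∑ i, ∑ j, A i j • fderiv ℝ (f j) a (f i a)) := by
      rw [hba, davieIncrement, map_add]
      abel
    rw [hsplit]
    refine norm_add_le_of_le ((norm_sub_sub_fderiv_le hC (hd j) (h2 j) a b).trans (by gcongr)) ?_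
    exact (ContinuousLinearMap.le_opNorm _ _).trans (mul_le_mul (h1 j a)
      (norm_sum_sum_smul_le hMW2 hA fun i j => norm_fderiv_apply_le hC h0 h1 i j a)
      (norm_nonneg _) hC)
  rw [davieIncrement_comp_sub]
  refine (norm_add_le_of_le (norm_sum_smul_le hMW hv hrem)
    (norm_sum_sum_smul_le hMW2 hB fun i j =>
      (norm_fderiv_apply_sub_le hC hd h0 h1 h2 i j a b).trans
        (mul_le_mul_of_nonneg_left hbaK (by positivity)))).trans_eq ?_
  ring

theorem exists_uniform_bound_of_iteratedFDeriv_bound (hfC : ∀ i, ContDiff ℝ 2 (f i))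
    (hfbd : ∀ i, ∀ k : ℕ, k ≤ 2 → ∃ C : ℝ, ∀ a : V, ‖iteratedFDeriv ℝ k (f i) a‖ ≤ C) :
    ∃ C : ℝ, 0 ≤ C ∧ (∀ i a, ‖f i a‖ ≤ C) ∧ (∀ i a, ‖fderiv ℝ (f i) a‖ ≤ C) ∧
      ∀ i a b, ‖fderiv ℝ (f i) b - fderiv ℝ (f i) a‖ ≤ C * ‖b - a‖ := by
  have hex : ∀ q : Fin d × Fin 3, ∃ C : ℝ, ∀ a : V, ‖iteratedFDeriv ℝ q.2 (f q.1) a‖ ≤ C :=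
    fun q => hfbd q.1 q.2 (by omega)
  choose c hc using hex
  have hle : ∀ i (k : Fin 3) a, ‖iteratedFDeriv ℝ k (f i) a‖ ≤ ∑ q, |c q| := fun i k a =>
    (hc (i, k) a).trans ((le_abs_self _).trans
      (Finset.single_le_sum (f := fun q => |c q|) (fun q _ => abs_nonneg _)
        (Finset.mem_univ (i, k))))
  refine ⟨∑ q, |c q|, by positivity, fun i a => ?_, fun i a => ?_, fun i a b => ?_⟩
  · simpa using hle i 0 a
  · simpa [norm_iteratedFDeriv_one] using hle i 1 a
  · have hd : Differentiable ℝ (fderiv ℝ (f i)) :=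
      ((hfC i).fderiv_right (m := 1) (by norm_num)).differentiable (by norm_num)
    refine convex_univ.norm_image_sub_le_of_norm_fderiv_le (𝕜 := ℝ) (fun x _ => hd x)
      (fun x _ => ?_) (Set.mem_univ a) (Set.mem_univ b)
    rw [← norm_iteratedFDeriv_one, norm_iteratedFDeriv_fderiv]
    exact hle i 2 x

end DavieIncrement

theorem IsControl.diag_eq_zero {T : ℝ} {ω : ℝ → ℝ → ℝ} (hω : IsControl T ω) {t : ℝ}
    (ht : 0 ≤ t) (htT : t ≤ T) : ω t t = 0 := by
  linarith [hω.1 t t ht le_rfl htT, hω.2.1 t t t ht le_rfl le_rfl htT]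

theorem IsControl.mono {T : ℝ} {ω : ℝ → ℝ → ℝ} (hω : IsControl T ω) {r s t u : ℝ}
    (hr : 0 ≤ r) (hrs : r ≤ s) (hst : s ≤ t) (htu : t ≤ u) (hu : u ≤ T) : ω s t ≤ ω r u := by
  linarith [hω.1 r s hr hrs (by linarith), hω.1 t u (by linarith) htu hu,
    hω.2.1 r s t hr hrs hst (by linarith), hω.2.1 r t u hr (hrs.trans hst) htu hu]

/-- **The Davie approximation is an almost flow.** Let `x = (x¹, x²)` be a
`T_{≤2}(ℝ^d)`-valued `p`-rough path with `2 ≤ p < 3` controlled by `ω`, and let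
`f_1, …, f_d : V → V` be bounded functions of class `C^2` with bounded first and second
derivatives. Then the Davie approximation
`φ_{t,s}(a) := a + Σ_i f_i(a) x^{(1),i}_{s,t} + Σ_{i,j} x^{(2),ij}_{s,t} Df_j(a)·f_i(a)`
is an almost flow; in particular
`‖φ_{t,s} ∘ φ_{s,r} − φ_{t,r}‖_∞ ≤ L ω_{r,t}^{3/p}` for all `0 ≤ r ≤ s ≤ t ≤ T`. -/
theorem davie_approximation_is_almost_flow
    (d : ℕ)
    {V : Type*} [NormedAddCommGroup V] [NormedSpace ℝ V] [CompleteSpace V]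
    (T p : ℝ) (hT : 0 ≤ T) (hp2 : 2 ≤ p) (hp3 : p < 3)
    (ω : ℝ → ℝ → ℝ) (hω : IsControl T ω)
    -- the rough path `x = 1 + x¹ + x²`, satisfying the Chen relations and the bounds
    (x1 : ℝ → ℝ → (Fin d → ℝ)) (x2 : ℝ → ℝ → (Fin d → Fin d → ℝ))
    (μ1 μ2 : ℝ)
    (hChen1 : ∀ r s t : ℝ, 0 ≤ r → r ≤ s → s ≤ t → t ≤ T → x1 r t = x1 r s + x1 s t)
    (hChen2 : ∀ r s t : ℝ, 0 ≤ r → r ≤ s → s ≤ t → t ≤ T →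
      ∀ i j : Fin d, x2 r t i j = x2 r s i j + x2 s t i j + x1 r s i * x1 s t j)
    (hx1bd : ∀ s t : ℝ, 0 ≤ s → s ≤ t → t ≤ T → ‖x1 s t‖ ≤ μ1 * ω s t ^ ((1 : ℝ) / p))
    (hx2bd : ∀ s t : ℝ, 0 ≤ s → s ≤ t → t ≤ T → ‖x2 s t‖ ≤ μ2 * ω s t ^ ((2 : ℝ) / p))
    -- the vector fields, bounded and of class `C^2` with bounded derivatives
    (f : Fin d → V → V)
    (hfC : ∀ i, ContDiff ℝ 2 (f i))
    (hfbd : ∀ i, ∀ k : ℕ, k ≤ 2 → ∃ C : ℝ, ∀ a : V, ‖iteratedFDeriv ℝ k (f i) a‖ ≤ C) :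
    -- `φ` is an almost flow:
    (∀ t : ℝ, 0 ≤ t → t ≤ T → ∀ a : V,
      (a + ∑ i : Fin d, x1 t t i • f i a
        + ∑ i : Fin d, ∑ j : Fin d, x2 t t i j • fderiv ℝ (f j) a (f i a)) = a) ∧
    (∃ δ : ℝ → ℝ, Continuous δ ∧ Monotone δ ∧ δ 0 = 0 ∧
      (∀ s t : ℝ, 0 ≤ s → s ≤ t → t ≤ T → ∀ a : V,
        ‖(∑ i : Fin d, x1 s t i • f i a
            + ∑ i : Fin d, ∑ j : Fin d, x2 s t i j • fderiv ℝ (f j) a (f i a))‖ ≤ δ T) ∧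
      (∀ s t : ℝ, 0 ≤ s → s ≤ t → t ≤ T →
        LipschitzWith (Real.toNNReal (1 + δ T))
          (fun a : V => a + ∑ i : Fin d, x1 s t i • f i a
            + ∑ i : Fin d, ∑ j : Fin d, x2 s t i j • fderiv ℝ (f j) a (f i a)))) ∧
    (∃ L : ℝ, 0 ≤ L ∧ ∀ r s t : ℝ, 0 ≤ r → r ≤ s → s ≤ t → t ≤ T → ∀ a : V,
      ‖(fun b : V => b + ∑ i : Fin d, x1 s t i • f i b
            + ∑ i : Fin d, ∑ j : Fin d, x2 s t i j • fderiv ℝ (f j) b (f i b))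
          ((fun b : V => b + ∑ i : Fin d, x1 r s i • f i b
            + ∑ i : Fin d, ∑ j : Fin d, x2 r s i j • fderiv ℝ (f j) b (f i b)) a)
        - (a + ∑ i : Fin d, x1 r t i • f i a
            + ∑ i : Fin d, ∑ j : Fin d, x2 r t i j • fderiv ℝ (f j) a (f i a))‖
        ≤ L * ω r t ^ ((3 : ℝ) / p)) := by
  obtain ⟨C, hC, h0, h1, h2⟩ := exists_uniform_bound_of_iteratedFDeriv_bound hfC hfbd
  have hd : ∀ i, Differentiable ℝ (f i) := fun i => (hfC i).differentiable (by norm_num)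
  have hp : 0 < p := by linarith
  set W : ℝ → ℝ → ℝ := fun s t => ω s t ^ ((1 : ℝ) / p) with hWdef
  have hWpow : ∀ (k : ℕ) (s t : ℝ), 0 ≤ s → s ≤ t → t ≤ T →
      ω s t ^ ((k : ℝ) / p) = W s t ^ k := fun k s t hs hst ht => by
    rw [hWdef, ← Real.rpow_natCast, ← Real.rpow_mul (hω.1 s t hs hst ht)]
    congr 1
    ring
  have hWnn : ∀ s t : ℝ, 0 ≤ s → s ≤ t → t ≤ T → 0 ≤ W s t := fun s t hs hst ht =>
    Real.rpow_nonneg (hω.1 s t hs hst ht) _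
  have hWmono : ∀ r s t u : ℝ, 0 ≤ r → r ≤ s → s ≤ t → t ≤ u → u ≤ T → W s t ≤ W r u :=
    fun r s t u hr hrs hst htu hu =>
      Real.rpow_le_rpow (hω.1 s t (hr.trans hrs) hst (htu.trans hu))
        (hω.mono hr hrs hst htu hu) (by positivity)
  set M : ℝ := max |μ1| |μ2|
  have hM : 0 ≤ M := (abs_nonneg μ1).trans (le_max_left _ _)
  have hx1 : ∀ s t : ℝ, 0 ≤ s → s ≤ t → t ≤ T → ∀ i, |x1 s t i| ≤ M * W s t :=
    fun s t hs hst ht i => ((norm_le_pi_norm (x1 s t) i).trans (hx1bd s t hs hst ht)).trans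
      (mul_le_mul_of_nonneg_right ((le_abs_self μ1).trans (le_max_left _ _)) (hWnn s t hs hst ht))
  have hx2 : ∀ s t : ℝ, 0 ≤ s → s ≤ t → t ≤ T → ∀ i j, |x2 s t i j| ≤ M * W s t ^ 2 :=
    fun s t hs hst ht i j => by
      have hbd := hx2bd s t hs hst ht
      have hpow := hWpow 2 s t hs hst ht
      rw [Nat.cast_ofNat] at hpow
      rw [hpow] at hbd
      exact (((norm_le_pi_norm (x2 s t i) j).trans (norm_le_pi_norm (x2 s t) i)).trans hbd).trans
        (mul_le_mul_of_nonneg_right ((le_abs_self μ2).trans (le_max_right _ _)) (sq_nonneg _))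
  have hWdiag : ∀ t : ℝ, 0 ≤ t → t ≤ T → W t t = 0 := fun t ht htT => by
    simp only [hWdef, hω.diag_eq_zero ht htT]
    exact Real.zero_rpow (by positivity)
  set W₀ : ℝ := W 0 T with hW₀def
  have hW₀ : 0 ≤ W₀ := hWnn 0 T le_rfl hT le_rfl
  have hx1' : ∀ s t : ℝ, 0 ≤ s → s ≤ t → t ≤ T → ∀ i, |x1 s t i| ≤ M * W₀ :=
    fun s t hs hst ht i => (hx1 s t hs hst ht i).trans
      (mul_le_mul_of_nonneg_left (hWmono 0 s t T le_rfl hs hst ht le_rfl) hM)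
  have hx2' : ∀ s t : ℝ, 0 ≤ s → s ≤ t → t ≤ T → ∀ i j, |x2 s t i j| ≤ M * W₀ ^ 2 :=
    fun s t hs hst ht i j => (hx2 s t hs hst ht i j).trans
      (mul_le_mul_of_nonneg_left (pow_le_pow_left₀ (hWnn s t hs hst ht)
        (hWmono 0 s t T le_rfl hs hst ht le_rfl) 2) hM)
  have hMW₀ : 0 ≤ M * W₀ := by positivity
  have hMW₀2 : 0 ≤ M * W₀ ^ 2 := by positivity
  set D : ℝ := d * (M * W₀ * C) + d * (d * (M * W₀ ^ 2 * (2 * C * C))) with hDdef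
  have hD : 0 ≤ D := by positivity
  have hδT : D / T * T = D := by
    rcases hT.eq_or_lt with hT0 | hTpos
    · have : W₀ = 0 := by rw [hW₀def, ← hT0]; exact hWdiag 0 le_rfl hT
      simp [hDdef, this]
    · field_simp
  simp only [add_assoc]
  refine ⟨fun t ht htT a => ?_, ⟨fun τ => D / T * τ, by fun_prop, fun σ τ h => ?_, by simp,
    fun s t hs hst ht a => ?_, fun s t hs hst ht => ?_⟩, ?_⟩
  · have hz1 : ∀ i, x1 t t i = 0 := fun i => by
      simpa [hWdiag t ht htT] using hx1 t t ht le_rfl htT i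
    have hz2 : ∀ i j, x2 t t i j = 0 := fun i j => by
      simpa [hWdiag t ht htT] using hx2 t t ht le_rfl htT i j
    simp [hz1, hz2]
  · exact mul_le_mul_of_nonneg_left h (by positivity)
  · beta_reduce
    rw [hδT]
    refine (norm_davieIncrement_le hC hMW₀ hMW₀2 (hx1' s t hs hst ht)
      (hx2' s t hs hst ht) h0 h1 a).trans ?_
    rw [hDdef]
    gcongr
    linarith
  · beta_reduce
    rw [hδT]
    refine LipschitzWith.of_dist_le_mul fun b a => ?_
    rw [Real.coe_toNNReal _ (by positivity), dist_eq_norm, dist_eq_norm]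
    have hinc := norm_davieIncrement_sub_le hC hMW₀ hMW₀2 (hx1' s t hs hst ht)
      (hx2' s t hs hst ht) hd h0 h1 h2 a b
    change ‖(b + davieIncrement f (x1 s t) (x2 s t) b)
      - (a + davieIncrement f (x1 s t) (x2 s t) a)‖ ≤ _
    rw [add_sub_add_comm]
    refine (norm_add_le_of_le le_rfl hinc).trans_eq ?_
    rw [hDdef]
    ring
  · set K : ℝ := d * (M * C) + d * (d * (M * W₀ * (C * C))) with hK
    refine ⟨d * (M * (C * K ^ 2 + C * (d * (d * (M * (C * C))))))
      + d * (d * (M * (2 * C * C * K))), by positivity, fun r s t hr hrs hst ht a => ?_⟩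
    have hs : 0 ≤ s := hr.trans hrs
    have hsT : s ≤ T := hst.trans ht
    have hrt : r ≤ t := hrs.trans hst
    have hWrs : W r s ≤ W r t := hWmono r r s t hr le_rfl hrs hst ht
    have hWst : W s t ≤ W r t := hWmono r s t t hr hrs hst le_rfl ht
    have hpow := hWpow 3 r t hr hrt ht
    rw [Nat.cast_ofNat] at hpow
    rw [hpow]
    have key := norm_davieIncrement_comp_sub_le (f := f) hC hM (hWnn r t hr hrt ht)
      (hWmono 0 r t T le_rfl hr hrt ht le_rfl)
      (fun i => (hx1 r s hr hrs hsT i).trans (mul_le_mul_of_nonneg_left hWrs hM))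
      (fun i => (hx1 s t hs hst ht i).trans (mul_le_mul_of_nonneg_left hWst hM))
      (fun i j => (hx2 r s hr hrs hsT i j).trans (mul_le_mul_of_nonneg_left
        (pow_le_pow_left₀ (hWnn r s hr hrs hsT) hWrs 2) hM))
      (fun i j => (hx2 s t hs hst ht i j).trans (mul_le_mul_of_nonneg_left
        (pow_le_pow_left₀ (hWnn s t hs hst ht) hWst 2) hM))
      hd h0 h1 h2 hK a
    have hx2rt : x2 r t = fun i j => x2 r s i j + x2 s t i j + x1 r s i * x1 s t j := by
      ext i j
      exact hChen2 r s t hr hrs hst ht i j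
    rw [← hChen1 r s t hr hrs hst ht, ← hx2rt] at key
    refine le_of_eq_of_le (congrArg norm ?_) key
    simp only [davieIncrement, add_assoc]
    abel
end
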